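/- Let a < b be reals, r > 0 with b > a + 2r, and φ ∈ (0,1). Let R = {w ∈ ℂ : a < Re w < b, |Im w| < r} and let V : [0,1] × R → ℂ be such that for each λ ∈ R the function x ↦ V(x,λ) is continuous, for each x ∈ [0,1] the function λ ↦ V(x,λ) is holomorphic on R and satisfies V(x,μ) ∈ ℝ for all μ ∈ (a,b), and sup{ |Im V(x,λ)| : x ∈ [0,1], λ ∈ R } ≤ r(1−φ)²/2. If λ ∈ R with a + r < Re λ < b − r and |Im λ| ≤ φ r is an eigenvalue of the quasi-periodic problem with some parameter k ∈ [0,2π), or a Dirichlet eigenvalue, or a Neumann eigenvalue, for the potential x ↦ V(x,λ), then λ is real. -/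

import Mathlib

open MeasureTheory

/-- `lam` is an eigenvalue of the quasi-periodic problem with parameter `k` for the
potential `W` on `[0,1]`: there is a nontrivial solution `y` of `-y'' + W y = lam y`
with `y(1) = e^{ik} y(0)`, `y'(1) = e^{ik} y'(0)`. -/
def HillQPEigen (W : ℝ → ℂ) (k : ℝ) (lam : ℂ) : Prop :=
  ∃ y yd : ℝ → ℂ,
    (∃ x ∈ Set.Icc (0:ℝ) 1, y x ≠ 0) ∧
    (∀ x ∈ Set.Icc (0:ℝ) 1, HasDerivWithinAt y (yd x) (Set.Icc (0:ℝ) 1) x) ∧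
    (∀ x ∈ Set.Icc (0:ℝ) 1,
      HasDerivWithinAt yd (W x * y x - lam * y x) (Set.Icc (0:ℝ) 1) x) ∧
    y 1 = Complex.exp (Complex.I * k) * y 0 ∧
    yd 1 = Complex.exp (Complex.I * k) * yd 0

/-- `lam` is a Dirichlet eigenvalue for the potential `W` on `[0,1]`. -/
def HillDirichletEigen (W : ℝ → ℂ) (lam : ℂ) : Prop :=
  ∃ y yd : ℝ → ℂ,
    (∃ x ∈ Set.Icc (0:ℝ) 1, y x ≠ 0) ∧
    (∀ x ∈ Set.Icc (0:ℝ) 1, HasDerivWithinAt y (yd x) (Set.Icc (0:ℝ) 1) x) ∧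
    (∀ x ∈ Set.Icc (0:ℝ) 1,
      HasDerivWithinAt yd (W x * y x - lam * y x) (Set.Icc (0:ℝ) 1) x) ∧
    y 0 = 0 ∧ y 1 = 0

/-- `lam` is a Neumann eigenvalue for the potential `W` on `[0,1]`. -/
def HillNeumannEigen (W : ℝ → ℂ) (lam : ℂ) : Prop :=
  ∃ y yd : ℝ → ℂ,
    (∃ x ∈ Set.Icc (0:ℝ) 1, y x ≠ 0) ∧
    (∀ x ∈ Set.Icc (0:ℝ) 1, HasDerivWithinAt y (yd x) (Set.Icc (0:ℝ) 1) x) ∧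
    (∀ x ∈ Set.Icc (0:ℝ) 1,
      HasDerivWithinAt yd (W x * y x - lam * y x) (Set.Icc (0:ℝ) 1) x) ∧
    yd 0 = 0 ∧ yd 1 = 0

open Complex Metric in
/-- A holomorphic function that is real at `c` and has imaginary part at most `M` on
the ball of radius `r` about `c` has imaginary part vanishing at least linearly at `c`. -/
lemma abs_im_le_of_im_le {f : ℂ → ℂ} {c z : ℂ} {r M : ℝ} (hM : 0 < M) (hr : 0 < r)
    (hf : DifferentiableOn ℂ f (ball c r)) (hfM : ∀ w ∈ ball c r, (f w).im ≤ M)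
    (hc : (f c).im = 0) (hz : z ∈ ball c r) :
    |(f z).im| ≤ 2 * M * ‖z - c‖ / (r - ‖z - c‖) := by
  have hmap : Set.MapsTo (fun w => w + c) (ball (0 : ℂ) r) (ball c r) := fun w hw => by
    simpa [dist_eq_norm] using hw
  have hg : DifferentiableOn ℂ (fun w => -I * (f (w + c) - f c)) (ball 0 r) :=
    ((hf.comp (by fun_prop) hmap).sub_const (f c)).const_mul (-I)
  have key := borelCaratheodory_zero (z := z - c) hM hg
    (fun w hw => by simpa [hc] using hfM _ (hmap hw)) hr
    (by simpa [dist_eq_norm] using hz) (by simp)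
  refine le_trans ?_ key
  simpa [hc] using abs_im_le_norm (f z - f c)

/-- A function with nonnegative derivative on `[0,1]` and equal values at the endpoints has zero
derivative. -/
lemma deriv_eq_zero_of_nonneg_of_endpoints_eq {F F' : ℝ → ℝ}
    (hF : ∀ x ∈ Set.Icc (0:ℝ) 1, HasDerivWithinAt F (F' x) (Set.Icc (0:ℝ) 1) x)
    (hF' : ∀ x ∈ Set.Icc (0:ℝ) 1, 0 ≤ F' x) (hend : F 1 = F 0) :
    ∀ x ∈ Set.Icc (0:ℝ) 1, F' x = 0 := by
  have hint : ∀ x ∈ interior (Set.Icc (0:ℝ) 1), HasDerivAt F (F' x) x := fun x hx =>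
    (hF x (interior_subset hx)).hasDerivAt (mem_interior_iff_mem_nhds.1 hx)
  have hmono : MonotoneOn F (Set.Icc (0:ℝ) 1) :=
    monotoneOn_of_deriv_nonneg (convex_Icc 0 1) (fun x hx => (hF x hx).continuousWithinAt)
      (fun x hx => (hint x hx).differentiableAt.differentiableWithinAt)
      (fun x hx => (hint x hx).deriv ▸ hF' x (interior_subset hx))
  have hconst : ∀ x ∈ Set.Icc (0:ℝ) 1, F x = F 0 := fun x hx =>
    le_antisymm (hend ▸ hmono hx (by simp) hx.2) (hmono (by simp) hx hx.1)
  intro x hx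
  exact (uniqueDiffOn_Icc_zero_one x hx).eq_deriv _ (hF x hx)
    ((hasDerivWithinAt_const x _ (F 0)).congr hconst (hconst x hx))

open Complex in
/-- If `|Im W| < |Im lam|` on `[0,1]`, then no nontrivial solution of `-y'' + W y = lam y` has
the same value of `Im (y' * conj y)` at both endpoints. -/
lemma im_eq_zero_of_solution {W y yd : ℝ → ℂ} {lam : ℂ}
    (hW : lam.im ≠ 0 → ∀ x ∈ Set.Icc (0:ℝ) 1, |(W x).im| < |lam.im|)
    (hne : ∃ x ∈ Set.Icc (0:ℝ) 1, y x ≠ 0)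
    (hy : ∀ x ∈ Set.Icc (0:ℝ) 1, HasDerivWithinAt y (yd x) (Set.Icc (0:ℝ) 1) x)
    (hyd : ∀ x ∈ Set.Icc (0:ℝ) 1,
      HasDerivWithinAt yd (W x * y x - lam * y x) (Set.Icc (0:ℝ) 1) x)
    (hend : (yd 1 * star (y 1)).im = (yd 0 * star (y 0)).im) : lam.im = 0 := by
  by_contra hν
  have hpos : ∀ x ∈ Set.Icc (0:ℝ) 1, 0 < lam.im ^ 2 - lam.im * (W x).im := fun x hx => by
    have h := mul_lt_mul_of_pos_left (hW hν x hx) (abs_pos.2 hν)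
    rw [← abs_mul, abs_mul_abs_self] at h
    nlinarith [le_abs_self (lam.im * (W x).im)]
  have hF : ∀ x ∈ Set.Icc (0:ℝ) 1, HasDerivWithinAt
      (fun t => -lam.im * (yd t * star (y t)).im)
      ((lam.im ^ 2 - lam.im * (W x).im) * normSq (y x)) (Set.Icc (0:ℝ) 1) x := fun x hx => by
    have h := ((imCLM.hasFDerivAt.comp_hasDerivWithinAt x
      ((hyd x hx).mul (hy x hx).star)).const_mul (-lam.im))
    refine h.congr_deriv ?_
    simp [normSq_apply]
    ring
  obtain ⟨x, hx, hyx⟩ := hne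
  have h0 := deriv_eq_zero_of_nonneg_of_endpoints_eq hF
    (fun x hx => mul_nonneg (hpos x hx).le (normSq_nonneg _)) (by simp only [hend]) x hx
  exact (mul_pos (hpos x hx) (normSq_pos.2 hyx)).ne' h0

theorem spectrum_real_in_rectangle
    (a b r φ : ℝ) (hr : 0 < r) (hb : a + 2 * r < b) (hφ : φ ∈ Set.Ioo (0:ℝ) 1)
    (V : ℝ → ℂ → ℂ)
    (hVx : ∀ lam : ℂ, a < lam.re → lam.re < b → |lam.im| < r →
      ContinuousOn (fun x => V x lam) (Set.Icc (0:ℝ) 1))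
    (hVhol : ∀ x ∈ Set.Icc (0:ℝ) 1,
      DifferentiableOn ℂ (V x) {w : ℂ | a < w.re ∧ w.re < b ∧ |w.im| < r})
    (hVreal : ∀ x ∈ Set.Icc (0:ℝ) 1, ∀ μ : ℝ, a < μ → μ < b → (V x μ).im = 0)
    (hVbound : ∀ x ∈ Set.Icc (0:ℝ) 1, ∀ w : ℂ, a < w.re → w.re < b → |w.im| < r →
      |(V x w).im| ≤ r * (1 - φ) ^ 2 / 2)
    (lam : ℂ) (h1 : a + r < lam.re) (h2 : lam.re < b - r) (h3 : |lam.im| ≤ φ * r)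
    (heig : (∃ k : ℝ, 0 ≤ k ∧ k < 2 * Real.pi ∧ HillQPEigen (fun x => V x lam) k lam) ∨
            HillDirichletEigen (fun x => V x lam) lam ∨
            HillNeumannEigen (fun x => V x lam) lam) :
    lam.im = 0 := by
  have hW : lam.im ≠ 0 → ∀ x ∈ Set.Icc (0:ℝ) 1, |(V x lam).im| < |lam.im| := by
    intro hν x hx
    have hν' := abs_pos.2 hν
    obtain ⟨hφ0, hφ1⟩ := hφ
    have hs : 0 < 1 - φ := by linarith
    have hball : ∀ w ∈ Metric.ball (lam.re : ℂ) r, a < w.re ∧ w.re < b ∧ |w.im| < r := by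
      intro w hw
      rw [Metric.mem_ball, dist_eq_norm] at hw
      have hre := abs_lt.1 ((Complex.abs_re_le_norm _).trans_lt hw)
      have him := (Complex.abs_im_le_norm _).trans_lt hw
      simp only [Complex.sub_re, Complex.ofReal_re, Complex.sub_im, Complex.ofReal_im,
        sub_zero] at hre him
      exact ⟨by linarith, by linarith, him⟩
    have hnorm : ‖lam - (lam.re : ℂ)‖ = |lam.im| := by
      have h : lam - (lam.re : ℂ) = (lam.im : ℂ) * Complex.I := by
        apply Complex.ext <;> simp
      simp [h]
    have hlt : |lam.im| < r := by nlinarith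
    have key := abs_im_le_of_im_le (f := V x) (c := lam.re) (z := lam)
      (M := r * (1 - φ) ^ 2 / 2) (by positivity) hr
      ((hVhol x hx).mono hball)
      (fun w hw => (le_abs_self _).trans
        (hVbound x hx w (hball w hw).1 (hball w hw).2.1 (hball w hw).2.2))
      (hVreal x hx _ (by linarith) (by linarith))
      (by rwa [Metric.mem_ball, dist_eq_norm, hnorm])
    rw [hnorm] at key
    refine key.trans_lt ?_
    rw [div_lt_iff₀ (by linarith)]
    have hgap : r * (1 - φ) ≤ r - |lam.im| := by linarith
    have hsq : r * (1 - φ) ^ 2 < r * (1 - φ) := by nlinarith [mul_pos hr hs]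
    nlinarith
  rcases heig with ⟨k, -, -, y, yd, hne, hy, hyd, h0, h1⟩ | ⟨y, yd, hne, hy, hyd, h0, h1⟩ |
    ⟨y, yd, hne, hy, hyd, h0, h1⟩
  · refine im_eq_zero_of_solution hW hne hy hyd ?_
    have hk : Complex.exp (Complex.I * k) * star (Complex.exp (Complex.I * k)) = 1 := by
      rw [Complex.star_def, Complex.mul_conj, Complex.normSq_eq_norm_sq, mul_comm,
        Complex.norm_exp_ofReal_mul_I]
      simp
    rw [h0, h1, star_mul', mul_mul_mul_comm, hk, one_mul]
  · exact im_eq_zero_of_solution hW hne hy hyd (by simp [h0, h1])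
  · exact im_eq_zero_of_solution hW hne hy hyd (by simp [h0, h1])
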